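/- Let B_m be a (periodic) exponential B-spline of order m ≥ 2 with knots 0,1,…,m. Then the Zak transform Z₁B_m has exactly one zero in the unit square [0,1)²; this zero lies on the line ω = 1/2, i.e. there is a unique x̃ ∈ [0,1) with Z₁B_m(x̃, 1/2) = 0 and Z₁B_m(x, ω) ≠ 0 for all (x,ω) ∈ [0,1)² with (x,ω) ≠ (x̃, 1/2). -/

import Mathlib

open MeasureTheory

/-- The Zak transform `Z_α f(x,ω) = ∑_{k∈ℤ} f(x-kα) e^{2πikαω}`. -/
noncomputable def Zak (α : ℝ) (f : ℝ → ℂ) (x ω : ℝ) : ℂ :=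
  ∑' k : ℤ, f (x - k * α) * Complex.exp (2 * Real.pi * Complex.I * k * α * ω)

/-- `e^{λx} χ_{[0,1)}(x)`. -/
noncomputable def expChi (l : ℝ) : ℝ → ℝ :=
  fun x => if x ∈ Set.Ico (0:ℝ) 1 then Real.exp (l * x) else 0

/-- Convolution of two functions on `ℝ`. -/
noncomputable def conv (f g : ℝ → ℝ) : ℝ → ℝ :=
  fun x => ∫ t : ℝ, f t * g (x - t)

/-- The exponential B-spline `B_Λ = e^{λ₁·}χ_{[0,1)} ∗ ⋯ ∗ e^{λ_m·}χ_{[0,1)}`. -/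
noncomputable def EB : List ℝ → ℝ → ℝ
  | [] => fun _ => 0
  | [l] => expChi l
  | l :: ls => conv (expChi l) (EB ls)

open scoped ComplexConjugate

/-- The operator `v ↦ e^{l·}χ_{[0,1)} ∗ v`, written as a sliding integral. -/
noncomputable def slide (l : ℝ) (v : ℝ → ℂ) (x : ℝ) : ℂ :=
  Real.exp (l * x) * ∫ s in (x - 1)..x, (Real.exp (-(l * s)) : ℂ) * v s

lemma continuous_integral_sub_one {E : Type*} [NormedAddCommGroup E] [NormedSpace ℝ E]
    {F : ℝ → E} (hF : ∀ a b, IntervalIntegrable F volume a b) :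
    Continuous fun x : ℝ => ∫ s in (x - 1)..x, F s := by
  have h : (fun x : ℝ => ∫ s in (x - 1)..x, F s) =
      fun x => (∫ s in (0:ℝ)..x, F s) - ∫ s in (0:ℝ)..(x - 1), F s := by
    funext x
    exact (intervalIntegral.integral_interval_sub_left (hF _ _) (hF _ _)).symm
  rw [h]
  have hc := intervalIntegral.continuous_primitive hF 0
  exact hc.sub (hc.comp (continuous_sub_right 1))

lemma conv_expChi (l : ℝ) (f : ℝ → ℝ) (x : ℝ) :
    conv (expChi l) f x =
      Real.exp (l * x) * ∫ s in (x - 1)..x, Real.exp (-(l * s)) * f s := by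
  have h1 : conv (expChi l) f x = ∫ t in (0:ℝ)..1, Real.exp (l * t) * f (x - t) := by
    rw [intervalIntegral.integral_of_le zero_le_one, ← integral_Ico_eq_integral_Ioc,
      ← integral_indicator measurableSet_Ico]
    unfold conv expChi
    congr 1
    funext t
    by_cases ht : t ∈ Set.Ico (0:ℝ) 1 <;> simp [ht]
  have h2 := intervalIntegral.integral_comp_sub_left (a := 0) (b := 1)
    (fun s => Real.exp (l * (x - s)) * f s) x
  simp only [sub_sub_cancel, sub_zero] at h2
  rw [h1, h2, ← intervalIntegral.integral_const_mul]
  congr 1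
  funext s
  rw [← mul_assoc, ← Real.exp_add]
  ring_nf

/-- Locally integrable functions supported in `[0, n]`. -/
def LocIntSupp (n : ℝ) (f : ℝ → ℝ) : Prop :=
  (∀ a b, IntervalIntegrable f volume a b) ∧ ∀ x, x < 0 ∨ n < x → f x = 0

lemma LocIntSupp.conv_expChi {n : ℝ} {f : ℝ → ℝ} (hf : LocIntSupp n f) (l : ℝ) :
    LocIntSupp (n + 1) (conv (expChi l) f) := by
  constructor
  · have hc : Continuous (conv (expChi l) f) := by
      rw [funext (_root_.conv_expChi l f)]
      refine (by fun_prop : Continuous fun x => Real.exp (l * x)).mul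
        (continuous_integral_sub_one fun a b => ?_)
      exact (hf.1 a b).continuousOn_mul (by fun_prop)
    exact fun a b => hc.intervalIntegrable a b
  · intro x hx
    rw [_root_.conv_expChi]
    rw [intervalIntegral.integral_congr (g := fun _ => 0)]
    · simp
    · intro s hs
      rw [Set.uIcc_of_le (by linarith)] at hs
      have : f s = 0 := hf.2 s (by
        rcases hx with hx | hx
        · left; linarith [hs.2]
        · right; linarith [hs.1])
      simp [this]

lemma locIntSupp_expChi (l : ℝ) : LocIntSupp 1 (expChi l) := by
  constructor
  · intro a b
    have h : expChi l = (Set.Ico (0:ℝ) 1).indicator fun x => Real.exp (l * x) := by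
      funext x
      simp [expChi, Set.indicator]
    rw [h, intervalIntegrable_iff]
    have hc : Continuous fun x => Real.exp (l * x) := by fun_prop
    exact (intervalIntegrable_iff.1 (hc.intervalIntegrable a b)).indicator measurableSet_Ico
  · intro x hx
    unfold expChi
    rw [if_neg]
    rintro ⟨h0, h1⟩
    rcases hx with hx | hx <;> linarith

section ZakTransform

variable {n : ℝ} {f : ℝ → ℝ}

lemma zak_eq_finset_sum (hf : ∀ x, x < 0 ∨ n < x → f x = 0) {a b x : ℝ}
    (hx : x ∈ Set.Icc a b) (ω : ℝ) :
    Zak 1 (fun t => (f t : ℂ)) x ω = ∑ k ∈ Finset.Icc ⌊a - n⌋ ⌈b⌉,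
      (f (x - k) : ℂ) * Complex.exp (2 * Real.pi * Complex.I * k * ω) := by
  unfold Zak
  rw [tsum_eq_sum (s := Finset.Icc ⌊a - n⌋ ⌈b⌉)]
  · simp
  · intro k hk
    rw [Finset.mem_Icc, not_and_or, not_le, not_le] at hk
    have : f (x - k) = 0 := hf _ (by
      rcases hk with hk | hk
      · right
        have := Int.lt_floor_iff.1 hk
        have h2 : (k : ℝ) < a - n := by linarith
        linarith [hx.1]
      · left
        have := Int.ceil_lt_iff.1 hk
        have h2 : b < (k : ℝ) := by linarith
        linarith [hx.2])
    simp [this]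

lemma LocIntSupp.intervalIntegrable_zak (hf : LocIntSupp n f) (ω a b : ℝ) :
    IntervalIntegrable (fun x => Zak 1 (fun t => (f t : ℂ)) x ω) volume a b := by
  have h : IntervalIntegrable (fun x => ∑ k ∈ Finset.Icc ⌊min a b - n⌋ ⌈max a b⌉,
      (f (x - k) : ℂ) * Complex.exp (2 * Real.pi * Complex.I * k * ω)) volume a b := by
    refine (IntervalIntegrable.sum (Finset.Icc ⌊min a b - n⌋ ⌈max a b⌉)
      (f := fun (k : ℤ) x => (f (x - k) : ℂ) * Complex.exp (2 * Real.pi * Complex.I * k * ω))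
      fun k _ => ?_).congr (fun x _ => by simp)
    refine IntervalIntegrable.mul_const ?_ _
    have := (hf.1 (a - k) (b - k)).comp_sub_right (k : ℝ)
    simp only [sub_add_cancel] at this
    exact ⟨this.1.ofReal, this.2.ofReal⟩
  refine h.congr ?_
  intro x hx
  exact (zak_eq_finset_sum hf.2 (Set.uIoc_subset_uIcc hx) ω).symm

lemma LocIntSupp.zak_conv_expChi (hf : LocIntSupp n f) (l ω x : ℝ) :
    Zak 1 (fun t => (conv (expChi l) f t : ℂ)) x ω =
      slide l (fun s => Zak 1 (fun t => (f t : ℂ)) s ω) x := by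
  have hf' : ∀ x, x < 0 ∨ n + 1 < x → f x = 0 := fun x hx =>
    hf.2 x (hx.imp id fun h => by linarith)
  have hx : x ∈ Set.Icc (x - 1) x := ⟨by linarith, le_rfl⟩
  have hint : ∀ k : ℤ, IntervalIntegrable (fun s => f (s - k)) volume (x - 1) x := fun k => by
    have := (hf.1 (x - 1 - k) (x - k)).comp_sub_right (k : ℝ)
    simpa only [sub_add_cancel] using this
  rw [zak_eq_finset_sum (hf.conv_expChi l).2 hx, slide]
  have hcongr : ∫ s in (x - 1)..x,
        (Real.exp (-(l * s)) : ℂ) * Zak 1 (fun t => (f t : ℂ)) s ω =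
      ∫ s in (x - 1)..x, ∑ k ∈ Finset.Icc ⌊x - 1 - (n + 1)⌋ ⌈x⌉,
        ((Real.exp (-(l * s)) * f (s - k) : ℝ) : ℂ) *
          Complex.exp (2 * Real.pi * Complex.I * k * ω) := by
    refine intervalIntegral.integral_congr fun s hs => ?_
    rw [Set.uIcc_of_le (by linarith)] at hs
    rw [zak_eq_finset_sum hf' hs, Finset.mul_sum]
    refine Finset.sum_congr rfl fun k _ => ?_
    push_cast
    ring
  rw [hcongr, intervalIntegral.integral_finsetSum, Finset.mul_sum]
  · refine Finset.sum_congr rfl fun k _ => ?_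
    rw [intervalIntegral.integral_mul_const, intervalIntegral.integral_ofReal, ← mul_assoc,
      ← Complex.ofReal_mul]
    congr 2
    rw [_root_.conv_expChi]
    have := intervalIntegral.integral_comp_sub_right (a := x - 1) (b := x)
      (fun s => Real.exp (-(l * s)) * f s) (k : ℝ)
    rw [show x - k - 1 = x - 1 - k by ring, ← this, ← intervalIntegral.integral_const_mul,
      ← intervalIntegral.integral_const_mul]
    congr 1
    funext s
    rw [← mul_assoc, ← mul_assoc, ← Real.exp_add, ← Real.exp_add]
    ring_nf
  · intro k _
    refine IntervalIntegrable.mul_const ?_ _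
    have hc : Continuous fun s => Real.exp (-(l * s)) := by fun_prop
    have := (hint k).continuousOn_mul hc.continuousOn
    exact ⟨this.1.ofReal, this.2.ofReal⟩

lemma zak_add_one (f : ℝ → ℂ) (x ω : ℝ) :
    Zak 1 f (x + 1) ω = Complex.exp (2 * Real.pi * Complex.I * ω) * Zak 1 f x ω := by
  unfold Zak
  rw [← (Equiv.addRight (1 : ℤ)).tsum_eq, ← tsum_mul_left]
  refine tsum_congr fun k => ?_
  simp only [Equiv.coe_addRight]
  rw [show (x + 1 - ((k + 1 : ℤ) : ℝ) * 1) = x - k * 1 by push_cast; ring,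
    mul_left_comm, ← Complex.exp_add]
  congr 2
  push_cast
  ring

lemma conj_zak (f : ℝ → ℝ) (x ω : ℝ) :
    conj (Zak 1 (fun t => (f t : ℂ)) x ω) = Zak 1 (fun t => (f t : ℂ)) x (1 - ω) := by
  unfold Zak
  rw [Complex.conj_tsum]
  refine tsum_congr fun k => ?_
  rw [map_mul, Complex.conj_ofReal, ← Complex.exp_conj]
  congr 1
  rw [← Complex.exp_periodic.int_mul k]
  congr 1
  simp only [map_mul, Complex.conj_ofReal, Complex.conj_I, map_ofNat, map_intCast]
  push_cast
  ring

lemma zak_expChi_of_mem {x : ℝ} (l : ℝ) (hx : x ∈ Set.Ico (0:ℝ) 1) (ω : ℝ) :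
    Zak 1 (fun t => (expChi l t : ℂ)) x ω = Real.exp (l * x) := by
  unfold Zak
  rw [tsum_eq_single 0]
  · simp [expChi, hx.1, hx.2]
  · intro k hk
    have : expChi l (x - k) = 0 := by
      unfold expChi
      rw [if_neg]
      rintro ⟨h0, h1⟩
      apply hk
      have h2 : (k : ℝ) < 1 := by linarith [hx.2]
      have h3 : (-1 : ℝ) < k := by linarith [hx.1]
      have h2' : k < 1 := by exact_mod_cast h2
      have h3' : -1 < k := by exact_mod_cast h3
      omega
    simp [this]

end ZakTransform

lemma quasiperiodic_add_int {v : ℝ → ℂ} {z : ℂ} (hz : z ≠ 0)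
    (hv : ∀ x, v (x + 1) = z * v x) (x : ℝ) (k : ℤ) : v (x + k) = z ^ k * v x := by
  induction k using Int.induction_on with
  | zero => simp
  | succ k ih =>
    have := hv (x + k)
    push_cast at ih ⊢
    rw [← add_assoc, this, ih, zpow_add_one₀ hz]
    ring
  | pred k ih =>
    have := hv (x + (-(k:ℝ) - 1))
    rw [show x + (-(k:ℝ) - 1) + 1 = x + ((-(k:ℤ) : ℤ) : ℝ) by push_cast; ring, ih] at this
    push_cast at this ⊢
    rw [zpow_sub_one₀ hz, mul_right_comm, this]
    field_simp

section Integral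

variable {F : ℝ → ℂ}

lemma im_mul_integral (hF : ∀ a b, IntervalIntegrable F volume a b) (c : ℂ) (a b : ℝ) :
    (c * ∫ s in a..b, F s).im = ∫ s in a..b, (c * F s).im := by
  have := Complex.imCLM.intervalIntegral_comp_comm ((hF a b).const_mul c)
  simp only [Complex.imCLM_apply] at this
  rw [this, intervalIntegral.integral_const_mul]

lemma im_mul_integral_nonneg (hF : ∀ a b, IntervalIntegrable F volume a b) {c : ℂ} {a b : ℝ}
    (hab : a ≤ b) (h : ∀ s ∈ Set.Icc a b, 0 ≤ (c * F s).im) :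
    0 ≤ (c * ∫ s in a..b, F s).im := by
  rw [im_mul_integral hF]
  exact intervalIntegral.integral_nonneg hab h

lemma im_mul_integral_pos (hF : ∀ a b, IntervalIntegrable F volume a b) {c : ℂ} {a b : ℝ}
    (hab : a < b) (h : ∀ s ∈ Set.Ioo a b, 0 < (c * F s).im) :
    0 < (c * ∫ s in a..b, F s).im := by
  rw [im_mul_integral hF]
  refine intervalIntegral.intervalIntegral_pos_of_pos_on ?_ h hab
  have := ((hF a b).const_mul c)
  exact ⟨this.1.im, this.2.im⟩

/-- `F` never vanishes and turns counterclockwise by at most a half-turn over a unit interval. -/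
def TurnsLeft (F : ℝ → ℂ) : Prop :=
  (∀ x, F x ≠ 0) ∧ ∀ x t, x ≤ t → t ≤ x + 1 → 0 ≤ (conj (F x) * F t).im

lemma TurnsLeft.real_mul (hT : TurnsLeft F) {c : ℝ → ℝ} (hc : ∀ x, 0 < c x) :
    TurnsLeft fun x => (c x : ℂ) * F x := by
  refine ⟨fun x => mul_ne_zero (by exact_mod_cast (hc x).ne') (hT.1 x), fun x t h1 h2 => ?_⟩
  have : conj ((c x : ℂ) * F x) * ((c t : ℂ) * F t)
      = ((c x * c t : ℝ) : ℂ) * (conj (F x) * F t) := by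
    rw [map_mul, Complex.conj_ofReal]
    push_cast
    ring
  simp only
  rw [this, Complex.im_ofReal_mul]
  exact mul_nonneg (mul_pos (hc x) (hc t)).le (hT.2 x t h1 h2)

lemma TurnsLeft.integral_nonneg (hT : TurnsLeft F)
    (hF : ∀ a b, IntervalIntegrable F volume a b) {a b c : ℝ} (hab : a ≤ b) (hbc : b ≤ c)
    (hca : c ≤ a + 1) : 0 ≤ (conj (∫ s in a..b, F s) * ∫ s in b..c, F s).im := by
  have key : ∀ p q : ℂ, (conj p * q).im = (-conj q * p).im := by
    intro p q
    simp
    ring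
  rw [key]
  refine im_mul_integral_nonneg hF hab fun r hr => ?_
  rw [← key]
  refine im_mul_integral_nonneg hF hbc fun s hs => ?_
  exact hT.2 r s (hr.2.trans hs.1) (by linarith [hr.1, hs.2])

lemma integral_add_one {w : ℂ} (hw : ∀ x, F (x + 1) = w * F x) (a b : ℝ) :
    ∫ s in (a + 1)..(b + 1), F s = w * ∫ s in a..b, F s := by
  rw [← intervalIntegral.integral_comp_add_right, ← intervalIntegral.integral_const_mul]
  simp only [hw]

lemma TurnsLeft.integral (hT : TurnsLeft F) (hF : ∀ a b, IntervalIntegrable F volume a b)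
    {w : ℂ} (hw : ∀ x, F (x + 1) = w * F x) (him : 0 < w.im) :
    TurnsLeft fun x => ∫ s in (x - 1)..x, F s := by
  constructor
  · intro x h0
    simp only at h0
    set p := F (x - 1) with hp
    have hpx : F x = w * p := by rw [hp, ← hw, sub_add_cancel]
    have hp0 : p ≠ 0 := hT.1 _
    have := im_mul_integral_pos hF (c := conj p - conj (w * p)) (a := x - 1) (b := x)
      (by linarith) (fun s hs => ?_)
    · rw [h0] at this
      simp at this
    · have h1 := hT.2 (x - 1) s hs.1.le (by linarith [hs.2])
      have h2 := hT.2 s x hs.2.le (by linarith [hs.1])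
      have h3 := hT.1 s
      rw [hpx] at h2
      rw [← hp] at h1
      generalize F s = y at *
      have hsplit : ((conj p - conj (w * p)) * y).im
          = (conj p * y).im + (conj y * (w * p)).im := by
        simp
        ring
      rw [hsplit]
      by_contra hcon
      have e1 : (conj p * y).im = 0 := by linarith
      have e2 : (conj y * (w * p)).im = 0 := by linarith
      have e3 : (conj y * (w * p)).im = (conj y * p).re * w.im + (conj y * p).im * w.re := by
        simp
        ring
      have e4 : (conj y * p).im = 0 := by
        simp at e1 ⊢
        linarith
      rw [e2, e4, zero_mul, add_zero] at e3
      have e5 : (conj y * p).re = 0 := by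
        rcases mul_eq_zero.1 e3.symm with h | h
        · exact h
        · exact absurd h him.ne'
      have e6 : conj y * p = 0 := Complex.ext e5 e4
      rcases mul_eq_zero.1 e6 with h | h
      · exact h3 (by simpa using h)
      · exact hp0 h
  · intro x t hxt htx
    have hA := hT.integral_nonneg hF (a := x - 1) (b := t - 1) (c := x) (by linarith)
      (by linarith) (by linarith)
    have hB := hT.integral_nonneg hF (a := t - 1) (b := x) (c := t) (by linarith)
      hxt (by linarith)
    have hwA := integral_add_one hw (x - 1) (t - 1)
    simp only [sub_add_cancel] at hwA
    rw [hwA] at hB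
    simp only
    rw [← intervalIntegral.integral_add_adjacent_intervals (hF (x - 1) (t - 1)) (hF _ x),
      ← intervalIntegral.integral_add_adjacent_intervals (hF (t - 1) x) (hF _ t), hwA]
    generalize (∫ s in (x - 1)..(t - 1), F s) = A at *
    generalize (∫ s in (t - 1)..x, F s) = B at *
    have hsplit : (conj (A + B) * (B + w * A)).im = (conj A * B).im + (conj B * (w * A)).im
        + (A.re ^ 2 + A.im ^ 2) * w.im := by
      simp
      ring
    rw [hsplit]
    positivity

end Integral

section Slide

variable {v : ℝ → ℂ} {z : ℂ}

lemma intervalIntegrable_exp_mul (hv : ∀ a b, IntervalIntegrable v volume a b) (l a b : ℝ) :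
    IntervalIntegrable (fun s => (Real.exp (-(l * s)) : ℂ) * v s) volume a b :=
  (hv a b).continuousOn_mul (by fun_prop)

lemma exp_mul_add_one (hz : ∀ x, v (x + 1) = z * v x) (l x : ℝ) :
    (Real.exp (-(l * (x + 1))) : ℂ) * v (x + 1) =
      (Real.exp (-l) * z) * ((Real.exp (-(l * x)) : ℂ) * v x) := by
  rw [hz, show -(l * (x + 1)) = -l + -(l * x) by ring, Real.exp_add]
  push_cast
  ring

lemma TurnsLeft.slide (hT : TurnsLeft v) (hv : ∀ a b, IntervalIntegrable v volume a b)
    (hz : ∀ x, v (x + 1) = z * v x) (him : 0 < z.im) (l : ℝ) : TurnsLeft (slide l v) := by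
  refine ((hT.real_mul fun x => Real.exp_pos (-(l * x))).integral
    (intervalIntegrable_exp_mul hv l) (exp_mul_add_one hz l) ?_).real_mul
    fun x => Real.exp_pos (l * x)
  rw [Complex.im_ofReal_mul]
  positivity

lemma slide_re (hv : ∀ a b, IntervalIntegrable v volume a b) (l x : ℝ) :
    (slide l v x).re =
      Real.exp (l * x) * ∫ s in (x - 1)..x, Real.exp (-(l * s)) * (v s).re := by
  have := Complex.reCLM.intervalIntegral_comp_comm (intervalIntegrable_exp_mul hv l (x - 1) x)
  simp only [Complex.reCLM_apply, Complex.re_ofReal_mul] at this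
  rw [slide, Complex.re_ofReal_mul, this]

lemma slide_re_pos (hv : ∀ a b, IntervalIntegrable v volume a b) (hpos : ∀ x, 0 < (v x).re)
    (l x : ℝ) : 0 < (slide l v x).re := by
  rw [slide_re hv]
  refine mul_pos (Real.exp_pos _) ?_
  refine intervalIntegral.intervalIntegral_pos_of_pos_on ?_
    (fun s _ => mul_pos (Real.exp_pos _) (hpos s)) (by linarith)
  have : IntervalIntegrable (fun s => (v s).re) volume (x - 1) x :=
    ⟨(hv _ _).1.re, (hv _ _).2.re⟩
  exact this.continuousOn_mul (by fun_prop)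

lemma exists_slide_re_zero (hv : ∀ a b, IntervalIntegrable v volume a b)
    (hz : ∀ x, v (x + 1) = -v x) (l : ℝ) (hz' : ∀ x, slide l v (x + 1) = -slide l v x)
    {x₀ : ℝ} (hpos : ∀ x ∈ Set.Ioo x₀ (x₀ + 1), 0 < (v x).re) :
    ∃ x₁, (slide l v x₁).re = 0 ∧ ∀ x ∈ Set.Ioo x₁ (x₁ + 1), 0 < (slide l v x).re := by
  set F : ℝ → ℝ := fun s => Real.exp (-(l * s)) * (v s).re with hFdef
  have hF : ∀ a b, IntervalIntegrable F volume a b := fun a b => by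
    have : IntervalIntegrable (fun s => (v s).re) volume a b := ⟨(hv _ _).1.re, (hv _ _).2.re⟩
    exact this.continuousOn_mul (by fun_prop)
  have hF1 : ∀ x, F (x - 1) = -(Real.exp l * F x) := fun x => by
    have h := hz (x - 1)
    rw [sub_add_cancel] at h
    simp only [hFdef, h, Complex.neg_re]
    rw [show -(l * (x - 1)) = l + -(l * x) by ring, Real.exp_add]
    ring
  have hFpos : ∀ x ∈ Set.Ioo x₀ (x₀ + 1), 0 < F x := fun x hx =>
    mul_pos (Real.exp_pos _) (hpos x hx)
  have hshift : ∀ a b, ∫ s in (a - 1)..(b - 1), F s = -(Real.exp l * ∫ s in a..b, F s) := by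
    intro a b
    rw [← intervalIntegral.integral_comp_sub_right, ← intervalIntegral.integral_const_mul,
      ← intervalIntegral.integral_neg]
    simp only [hF1]
  set U : ℝ → ℝ := fun x => ∫ s in (x - 1)..x, F s with hUdef
  have hU : ∀ x, (slide l v x).re = Real.exp (l * x) * U x := fun x => slide_re hv l x
  have hUc : Continuous U := continuous_integral_sub_one hF
  have hint : ∀ a b, x₀ ≤ a → a < b → b ≤ x₀ + 1 → 0 < ∫ s in a..b, F s := fun a b h1 h2 h3 =>
    intervalIntegral.intervalIntegral_pos_of_pos_on (hF a b)
      (fun s hs => hFpos s ⟨by linarith [hs.1], by linarith [hs.2]⟩) h2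
  have hmono : ∀ a b, x₀ ≤ a → a < b → b ≤ x₀ + 1 → U a < U b := by
    intro a b h1 h2 h3
    have e1 := intervalIntegral.integral_add_adjacent_intervals (hF (a - 1) (b - 1)) (hF _ a)
    have e2 := intervalIntegral.integral_add_adjacent_intervals (hF (b - 1) a) (hF _ b)
    have e3 := hshift a b
    have e4 := hint a b h1 h2 h3
    have e5 := mul_pos (Real.exp_pos l) e4
    simp only [hUdef]
    linarith
  have hone : 0 < U (x₀ + 1) := by
    have := hint x₀ (x₀ + 1) le_rfl (by linarith) le_rfl
    simpa [hUdef] using this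
  have hzero : U x₀ < 0 := by
    have e1 := hshift x₀ (x₀ + 1)
    have e2 := mul_pos (Real.exp_pos l) (hint x₀ (x₀ + 1) le_rfl (by linarith) le_rfl)
    rw [add_sub_cancel_right] at e1
    simp only [hUdef]
    linarith
  obtain ⟨x₁, hx₁, hUx₁⟩ := intermediate_value_Icc (by linarith : x₀ ≤ x₀ + 1)
    hUc.continuousOn (⟨hzero.le, hone.le⟩ : (0:ℝ) ∈ Set.Icc (U x₀) (U (x₀ + 1)))
  refine ⟨x₁, by rw [hU, hUx₁, mul_zero], fun x hx => ?_⟩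
  rcases le_or_gt x (x₀ + 1) with h | h
  · rw [hU]
    refine mul_pos (Real.exp_pos _) ?_
    rw [← hUx₁]
    exact hmono x₁ x hx₁.1 hx.1 h
  · have h1 := hz' (x - 1)
    rw [sub_add_cancel] at h1
    rw [h1, Complex.neg_re, hU]
    have h2 := hmono (x - 1) x₁ (by linarith) (by linarith [hx.2]) hx₁.2
    rw [hUx₁] at h2
    have := mul_neg_of_pos_of_neg (Real.exp_pos (l * (x - 1))) h2
    linarith

end Slide

lemma exists_locIntSupp_EB (l : ℝ) (ls : List ℝ) : ∃ n, LocIntSupp n (EB (l :: ls)) := by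
  induction ls generalizing l with
  | nil => exact ⟨1, locIntSupp_expChi l⟩
  | cons l' ls ih =>
    obtain ⟨n, hn⟩ := ih l'
    exact ⟨n + 1, hn.conv_expChi l⟩

lemma intervalIntegrable_zak_EB (l : ℝ) (ls : List ℝ) (ω a b : ℝ) :
    IntervalIntegrable (fun x => Zak 1 (fun t => (EB (l :: ls) t : ℂ)) x ω) volume a b :=
  (exists_locIntSupp_EB l ls).choose_spec.intervalIntegrable_zak ω a b

lemma zak_EB_cons (l l' : ℝ) (ls : List ℝ) (ω : ℝ) :
    (fun x => Zak 1 (fun t => (EB (l :: l' :: ls) t : ℂ)) x ω) =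
      slide l fun x => Zak 1 (fun t => (EB (l' :: ls) t : ℂ)) x ω := by
  obtain ⟨n, hn⟩ := exists_locIntSupp_EB l' ls
  funext x
  exact hn.zak_conv_expChi l ω x

lemma zak_expChi (l x ω : ℝ) :
    Zak 1 (fun t => (expChi l t : ℂ)) x ω =
      Complex.exp (2 * Real.pi * Complex.I * ω) ^ ⌊x⌋ * Real.exp (l * Int.fract x) := by
  have h := quasiperiodic_add_int (v := fun x => Zak 1 (fun t => (expChi l t : ℂ)) x ω)
    (Complex.exp_ne_zero (2 * Real.pi * Complex.I * ω))
    (fun x => zak_add_one (fun t => (expChi l t : ℂ)) x ω) (Int.fract x) ⌊x⌋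
  rw [Int.fract_add_floor] at h
  rw [h, zak_expChi_of_mem l ⟨Int.fract_nonneg x, Int.fract_lt_one x⟩]

lemma im_exp_two_pi_pos {ω : ℝ} (h0 : 0 < ω) (h1 : ω < 1 / 2) :
    0 < (Complex.exp (2 * Real.pi * Complex.I * ω)).im := by
  rw [show (2 * Real.pi * Complex.I * ω : ℂ) = ((2 * Real.pi * ω : ℝ) : ℂ) * Complex.I by
    push_cast; ring, Complex.exp_ofReal_mul_I_im]
  apply Real.sin_pos_of_pos_of_lt_pi
  · have := Real.pi_pos
    positivity
  · nlinarith [Real.pi_pos]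

lemma turnsLeft_zak_expChi (l : ℝ) {ω : ℝ} (h0 : 0 < ω) (h1 : ω < 1 / 2) :
    TurnsLeft fun x => Zak 1 (fun t => (expChi l t : ℂ)) x ω := by
  have hstep : TurnsLeft fun x => Complex.exp (2 * Real.pi * Complex.I * ω) ^ ⌊x⌋ := by
    have him := im_exp_two_pi_pos h0 h1
    have hnorm : conj (Complex.exp (2 * Real.pi * Complex.I * ω)) *
        Complex.exp (2 * Real.pi * Complex.I * ω) = 1 := by
      rw [← Complex.exp_conj, ← Complex.exp_add, Complex.exp_eq_one_iff]
      exact ⟨0, by simp [Complex.conj_ofNat]⟩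
    have hne := Complex.exp_ne_zero (2 * Real.pi * Complex.I * ω)
    generalize Complex.exp (2 * Real.pi * Complex.I * ω) = z at *
    have hpow : ∀ k : ℤ, conj (z ^ k) * z ^ k = 1 := fun k => by
      rw [map_zpow₀, ← mul_zpow, hnorm, one_zpow]
    refine ⟨fun x => zpow_ne_zero _ hne, fun x t hxt htx => ?_⟩
    have hle := Int.floor_le_floor hxt
    have hle' := Int.floor_le_floor htx
    rw [Int.floor_add_one] at hle'
    have hcases : ⌊t⌋ = ⌊x⌋ ∨ ⌊t⌋ = ⌊x⌋ + 1 := by omega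
    rcases hcases with h | h
    · simp only [h, hpow, Complex.one_im, le_refl]
    · simp only [h]
      rw [zpow_add_one₀ hne, ← mul_assoc, hpow, one_mul]
      exact him.le
  have := hstep.real_mul fun x => Real.exp_pos (l * Int.fract x)
  convert this using 2 with x
  rw [zak_expChi, mul_comm]

lemma turnsLeft_zak_EB (l : ℝ) (ls : List ℝ) {ω : ℝ} (h0 : 0 < ω) (h1 : ω < 1 / 2) :
    TurnsLeft fun x => Zak 1 (fun t => (EB (l :: ls) t : ℂ)) x ω := by
  induction ls generalizing l with
  | nil => exact turnsLeft_zak_expChi l h0 h1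
  | cons l' ls ih =>
    rw [zak_EB_cons]
    exact (ih l').slide (intervalIntegrable_zak_EB l' ls ω) (fun x => zak_add_one _ x ω)
      (im_exp_two_pi_pos h0 h1) l

lemma zak_EB_zero_re_pos (l : ℝ) (ls : List ℝ) (x : ℝ) :
    0 < (Zak 1 (fun t => (EB (l :: ls) t : ℂ)) x 0).re := by
  induction ls generalizing l x with
  | nil =>
    change 0 < (Zak 1 (fun t => (expChi l t : ℂ)) x 0).re
    rw [zak_expChi]
    simp only [Complex.ofReal_zero, mul_zero, Complex.exp_zero, one_zpow, one_mul,
      Complex.ofReal_re]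
    positivity
  | cons l' ls ih =>
    rw [congrFun (zak_EB_cons l l' ls 0) x]
    exact slide_re_pos (intervalIntegrable_zak_EB l' ls 0) (ih l') l x

lemma zak_half_add_one (f : ℝ → ℂ) (x : ℝ) : Zak 1 f (x + 1) (1 / 2) = -Zak 1 f x (1 / 2) := by
  rw [zak_add_one, show (2 * Real.pi * Complex.I * ((1 / 2 : ℝ) : ℂ)) = Real.pi * Complex.I by
    push_cast; ring, Complex.exp_pi_mul_I]
  ring

lemma zak_half_im (f : ℝ → ℝ) (x : ℝ) : (Zak 1 (fun t => (f t : ℂ)) x (1 / 2)).im = 0 := by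
  have h := conj_zak f x (1 / 2)
  rw [show (1 - 1 / 2 : ℝ) = 1 / 2 by norm_num] at h
  exact Complex.conj_eq_iff_im.1 h

lemma exists_zak_EB_half_zero (l l' : ℝ) (ls : List ℝ) :
    ∃ x₁, (Zak 1 (fun t => (EB (l :: l' :: ls) t : ℂ)) x₁ (1 / 2)).re = 0 ∧
      ∀ x ∈ Set.Ioo x₁ (x₁ + 1),
        0 < (Zak 1 (fun t => (EB (l :: l' :: ls) t : ℂ)) x (1 / 2)).re := by
  have step : ∀ (l l' : ℝ) (ls : List ℝ) (x₀ : ℝ),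
      (∀ x ∈ Set.Ioo x₀ (x₀ + 1),
        0 < (Zak 1 (fun t => (EB (l' :: ls) t : ℂ)) x (1 / 2)).re) →
      ∃ x₁, (Zak 1 (fun t => (EB (l :: l' :: ls) t : ℂ)) x₁ (1 / 2)).re = 0 ∧
        ∀ x ∈ Set.Ioo x₁ (x₁ + 1),
          0 < (Zak 1 (fun t => (EB (l :: l' :: ls) t : ℂ)) x (1 / 2)).re := by
    intro l l' ls x₀ h
    have e := congrFun (zak_EB_cons l l' ls (1 / 2))
    have := exists_slide_re_zero (intervalIntegrable_zak_EB l' ls (1 / 2))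
      (fun x => zak_half_add_one _ x) l (fun x => by
        rw [← e, ← e]
        exact zak_half_add_one _ x) h
    simpa only [← e] using this
  induction ls generalizing l l' with
  | nil =>
    refine step l l' [] 0 fun x hx => ?_
    change 0 < (Zak 1 (fun t => (expChi l' t : ℂ)) x (1 / 2)).re
    rw [zak_expChi_of_mem l' ⟨hx.1.le, by linarith [hx.2]⟩, Complex.ofReal_re]
    positivity
  | cons l'' ls ih =>
    obtain ⟨x₀, -, h⟩ := ih l' l''
    exact step l l' (l'' :: ls) x₀ h

theorem zak_EB_unique_zero (m : ℕ) (hm : 2 ≤ m) (Λ : List ℝ) (hlen : Λ.length = m) :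
    ∃ x₀ ∈ Set.Ico (0:ℝ) 1,
      Zak 1 (fun t => (EB Λ t : ℂ)) x₀ (1/2) = 0 ∧
      ∀ x ∈ Set.Ico (0:ℝ) 1, ∀ ω ∈ Set.Ico (0:ℝ) 1,
        (x, ω) ≠ (x₀, (1:ℝ)/2) → Zak 1 (fun t => (EB Λ t : ℂ)) x ω ≠ 0 := by
  match Λ, hlen with
  | [], h => simp at h; omega
  | [_], h => simp at h; omega
  | l :: l' :: ls, _ =>
    obtain ⟨x₁, hx₁, hpos⟩ := exists_zak_EB_half_zero l l' ls
    have hzero : Zak 1 (fun t => (EB (l :: l' :: ls) t : ℂ)) x₁ (1 / 2) = 0 :=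
      Complex.ext hx₁ (zak_half_im _ _)
    have hshift := quasiperiodic_add_int (z := -1)
      (v := fun x => Zak 1 (fun t => (EB (l :: l' :: ls) t : ℂ)) x (1 / 2)) (by norm_num)
      (fun x => (zak_half_add_one (fun t => (EB (l :: l' :: ls) t : ℂ)) x).trans
        (neg_one_mul _).symm)
    refine ⟨Int.fract x₁, ⟨Int.fract_nonneg _, Int.fract_lt_one _⟩, ?_, ?_⟩
    · have h := hshift (Int.fract x₁) ⌊x₁⌋
      rw [Int.fract_add_floor, hzero] at h
      exact (mul_eq_zero.1 h.symm).resolve_left (zpow_ne_zero _ (by norm_num))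
    · intro x hx ω hω hne h0
      rcases eq_or_lt_of_le hω.1 with h | hω0
      · have := zak_EB_zero_re_pos l (l' :: ls) x
        subst h
        rw [h0] at this
        exact absurd this (lt_irrefl _)
      rcases lt_trichotomy ω (1 / 2) with h | h | h
      · exact (turnsLeft_zak_EB l (l' :: ls) hω0 h).1 x h0
      · subst h
        have hk := hshift x (-⌊x - x₁⌋)
        rw [h0, mul_zero] at hk
        have e : x + ((-⌊x - x₁⌋ : ℤ) : ℝ) = x₁ + Int.fract (x - x₁) := by
          rw [Int.fract]
          push_cast
          ring
        rw [e] at hk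
        rcases eq_or_lt_of_le (Int.fract_nonneg (x - x₁)) with hf | hf
        · apply hne
          have e2 : x = x₁ + (⌊x - x₁⌋ : ℤ) := by
            rw [Int.fract] at hf
            linarith
          have e3 : Int.fract x = Int.fract x₁ := by
            rw [e2, Int.fract_add_intCast]
          rw [Int.fract_eq_self.2 hx] at e3
          rw [e3]
        · have := hpos (x₁ + Int.fract (x - x₁))
            ⟨by linarith, by linarith [Int.fract_lt_one (x - x₁)]⟩
          rw [hk] at this
          simp at this
      · refine (turnsLeft_zak_EB l (l' :: ls) (ω := 1 - ω) (by linarith [hω.2])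
          (by linarith)).1 x ?_
        simp only
        rw [← conj_zak, h0, map_zero]
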